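/- Let 0 < r < R with 4R < 1, α ∈ (0,1], β ∈ (0,1], R̃ = αR, r̃ = αr, Δ = R̃ − r̃, E(x) = xΔ + r̃, V(x) = x(1−x)Δ². For p★ ∈ [0,1] define α·Y(p¹,p²) = ē₁(p¹,p²)·[E(p★) + 2β·E(p★)·(E(p★) − E(p̄)) + 2β·V(p★)] + 2β·E(p★)·E(p̄), where p̄ = (p¹+p²)/2 and ē₁(p¹,p²) = 2E(p̄) + βΔ²[3p̄(1−p̄) + (1/4)(p¹−p²)²]. Then the mixed second partial derivative ∂²Y/(∂p¹∂p²) is strictly negative on [0,1]², i.e., expected team output is strictly submodular in the two members' priors. -/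

import Mathlib

theorem deriv_cubic (a b c d x : ℝ) :
    deriv (fun t : ℝ => a + b * t + c * t ^ 2 + d * t ^ 3) x = b + 2 * c * x + 3 * d * x ^ 2 := by
  have h := ((((hasDerivAt_id x).const_mul b).const_add a).add
    (((hasDerivAt_id x).pow 2).const_mul c)).add (((hasDerivAt_id x).pow 3).const_mul d)
  refine (h.congr_deriv ?_).deriv
  simp
  ring

/-- The mixed second derivative of a product of a quadratic `e` in two variables and an affine
function of the sum, plus a further affine function of the sum. -/
theorem deriv_deriv_team_output (k D ρ γ m n q x₀ y₀ : ℝ) :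
    deriv (fun y => deriv (fun x => k * ((2 * ((x + y) / 2 * D + ρ) + γ *
        (3 * ((x + y) / 2) * (1 - (x + y) / 2) + (1 / 4) * (x - y) ^ 2)) *
        (m + n * (q - ((x + y) / 2 * D + ρ))) + n * ((x + y) / 2 * D + ρ))) x₀) y₀ =
      k * (-2 * γ * (m + n * (q - ((x₀ + y₀) / 2 * D + ρ)))
        - n * D / 2 * (2 * D + 3 * γ * (1 - (x₀ + y₀)))) := by
  have inner : ∀ y, deriv (fun x => k * ((2 * ((x + y) / 2 * D + ρ) + γ *
        (3 * ((x + y) / 2) * (1 - (x + y) / 2) + (1 / 4) * (x - y) ^ 2)) *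
        (m + n * (q - ((x + y) / 2 * D + ρ))) + n * ((x + y) / 2 * D + ρ))) x₀ =
      k * ((D + γ * (3 / 2 - x₀ - 2 * y)) * (m + n * (q - ((x₀ + y) / 2 * D + ρ)))
        - n * D / 2 * (D * (x₀ + y) + 2 * ρ + γ * (3 / 2 * (x₀ + y) - x₀ ^ 2 / 2 - y ^ 2 / 2
          - 2 * x₀ * y)) + n * D / 2) := by
    intro y
    -- Expand in powers of `x`, with `e = e₀ + e₁ x - γ / 2 x ^ 2` and bracket `g - n D / 2 x`.
    trans deriv (fun x : ℝ =>
      k * ((D * y + 2 * ρ + γ * (3 / 2 * y - y ^ 2 / 2)) * (m + n * (q - (y / 2 * D + ρ)))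
        + n * (y / 2 * D + ρ))
      + k * ((D + γ * (3 / 2 - 2 * y)) * (m + n * (q - (y / 2 * D + ρ)))
        - (D * y + 2 * ρ + γ * (3 / 2 * y - y ^ 2 / 2)) * (n * D / 2) + n * D / 2) * x
      + k * (-(γ / 2) * (m + n * (q - (y / 2 * D + ρ)))
        - (D + γ * (3 / 2 - 2 * y)) * (n * D / 2)) * x ^ 2
      + k * (γ / 2 * (n * D / 2)) * x ^ 3) x₀
    · congr 1
      funext x
      ring
    · rw [deriv_cubic]
      ring
  simp only [inner]
  trans deriv (fun y : ℝ =>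
    k * ((D + γ * (3 / 2 - x₀)) * (m + n * (q - (x₀ / 2 * D + ρ)))
      - n * D / 2 * (D * x₀ + 2 * ρ + γ * (3 / 2 * x₀ - x₀ ^ 2 / 2)) + n * D / 2)
    + k * (-2 * γ * (m + n * (q - (x₀ / 2 * D + ρ))) - (D + γ * (3 / 2 - x₀)) * (n * D / 2)
      - n * D / 2 * (D + γ * (3 / 2 - 2 * x₀))) * y
    + k * (2 * γ * (n * D / 2) + n * D / 2 * (γ / 2)) * y ^ 2 + 0 * y ^ 3) y₀
  · congr 1
    funext y
    ring
  · rw [deriv_cubic]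
    ring


theorem stmt_7
    (r R α β : ℝ)
    (hr : 0 < r) (hrR : r < R) (hbound : 4 * R < 1)
    (hα : α ∈ Set.Ioc (0:ℝ) 1) (hβ : β ∈ Set.Ioc (0:ℝ) 1)
    (pstar : ℝ) (hpstar : pstar ∈ Set.Icc (0:ℝ) 1) :
    let R' := α * R
    let r' := α * r
    let Δ := R' - r'
    let E : ℝ → ℝ := fun x => x * Δ + r'
    let V : ℝ → ℝ := fun x => x * (1 - x) * Δ ^ 2
    let ebar : ℝ → ℝ → ℝ := fun p₁ p₂ =>
      2 * E ((p₁ + p₂) / 2) + β * Δ ^ 2 *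
        (3 * ((p₁ + p₂) / 2) * (1 - (p₁ + p₂) / 2) + (1 / 4) * (p₁ - p₂) ^ 2)
    let Y : ℝ → ℝ → ℝ := fun p₁ p₂ => (1 / α) *
      (ebar p₁ p₂ * (E pstar + 2 * β * E pstar * (E pstar - E ((p₁ + p₂) / 2))
          + 2 * β * V pstar)
        + 2 * β * E pstar * E ((p₁ + p₂) / 2))
    ∀ p₁ ∈ Set.Icc (0:ℝ) 1, ∀ p₂ ∈ Set.Icc (0:ℝ) 1,
      deriv (fun y => deriv (fun x => Y x y) p₁) p₂ < 0 := by
  intro R' r' Δ E V ebar Y p₁ hp₁ p₂ hp₂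
  obtain ⟨hα0, hα1⟩ := hα
  obtain ⟨hβ0, hβ1⟩ := hβ
  obtain ⟨hs0, hs1⟩ := hpstar
  obtain ⟨ha0, ha1⟩ := hp₁
  obtain ⟨hb0, hb1⟩ := hp₂
  have hr' : 0 < r' := mul_pos hα0 hr
  have hΔ : 0 < Δ := sub_pos.2 (mul_lt_mul_of_pos_left hrR hα0)
  have hΔ4 : 4 * Δ < 1 := by
    have : R' ≤ R := mul_le_of_le_one_left (by linarith) hα1
    have : Δ < R' := sub_lt_self _ hr'
    linarith
  have hβΔ : 4 * (β * Δ) < 1 := by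
    have : β * Δ ≤ Δ := mul_le_of_le_one_left hΔ.le hβ1
    linarith
  have hEs : 0 < E pstar := add_pos_of_nonneg_of_pos (mul_nonneg hs0 hΔ.le) hr'
  have hVs : 0 ≤ V pstar := mul_nonneg (mul_nonneg hs0 (by linarith)) (sq_nonneg Δ)
  have hdiff : E ((p₁ + p₂) / 2) - E pstar ≤ Δ := by
    have : ((p₁ + p₂) / 2 - pstar) * Δ ≤ 1 * Δ :=
      mul_le_mul_of_nonneg_right (by linarith) hΔ.le
    simp only [E]
    linarith
  have hfac : 0 < 1 + 2 * β * (E pstar - E ((p₁ + p₂) / 2)) := by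
    have := mul_le_mul_of_nonneg_left hdiff hβ0.le
    linarith
  have hbracket : 0 < (E pstar + 2 * β * V pstar) +
      2 * β * E pstar * (E pstar - E ((p₁ + p₂) / 2)) := by
    have := mul_pos hEs hfac
    have := mul_nonneg hβ0.le hVs
    linarith
  have hsum : 0 < 2 * Δ + 3 * (β * Δ ^ 2) * (1 - (p₁ + p₂)) := by
    have h1 : 0 < β * Δ := mul_pos hβ0 hΔ
    have h2 : β * Δ * (-1) ≤ β * Δ * (1 - (p₁ + p₂)) :=
      mul_le_mul_of_nonneg_left (by linarith) h1.le
    have h3 : 0 < Δ * (2 + 3 * (β * Δ * (1 - (p₁ + p₂)))) := mul_pos hΔ (by linarith)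
    linarith
  have key := deriv_deriv_team_output (1 / α) Δ r' (β * Δ ^ 2) (E pstar + 2 * β * V pstar)
    (2 * β * E pstar) (E pstar) p₁ p₂
  have hY : ∀ x y, Y x y = 1 / α * ((2 * ((x + y) / 2 * Δ + r') + β * Δ ^ 2 *
      (3 * ((x + y) / 2) * (1 - (x + y) / 2) + (1 / 4) * (x - y) ^ 2)) *
      (E pstar + 2 * β * V pstar + 2 * β * E pstar * (E pstar - ((x + y) / 2 * Δ + r')))
      + 2 * β * E pstar * ((x + y) / 2 * Δ + r')) := by
    intro x y
    simp only [Y, ebar, E]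
    ring
  simp only [hY]
  rw [key]
  refine mul_neg_of_pos_of_neg (one_div_pos.2 hα0) ?_
  have h1 := mul_pos (mul_pos hβ0 (pow_pos hΔ 2)) hbracket
  have h2 := mul_pos (mul_pos (mul_pos hβ0 hEs) hΔ) hsum
  simp only [E] at h1 h2 ⊢
  linarith
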